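/- (Local twisted de Rham isomorphism.) For every nilpotent element B ∈ A, multiplication by exp(−B) induces an isomorphism of additive groups ker(d)/im(d) ≅ ker(d_{dB})/im(d_{dB}) between the cohomology of the untwisted complex (A, d) and the cohomology of the twisted complex (A, d_{dB}). (Both d and d_{dB} square to zero, so both quotient groups are defined.) -/

import Mathlib

/- The exponential `exp N = ∑_{k} N^k / k!` of a nilpotent element `N` of a
commutative ℚ-algebra; the sum is finite since `N` is nilpotent.
(For non-nilpotent `N` we set the value to `0` by convention.) -/
open scoped Classical in
noncomputable def nilExp {A : Type*} [CommRing A] [Algebra ℚ A] (N : A) : A :=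
  if h : IsNilpotent N then
    ∑ k ∈ Finset.range (Nat.find h), (k.factorial : ℚ)⁻¹ • N ^ k
  else 0

/-- A derivation acts on the exponential of a nilpotent element by the chain rule. -/
theorem Derivation.map_isNilpotent_exp {A : Type*} [CommRing A] [Algebra ℚ A]
    (δ : Derivation ℚ A A) {N : A} (hN : IsNilpotent N) :
    δ (IsNilpotent.exp N) = IsNilpotent.exp N * δ N := by
  obtain ⟨n, hn⟩ := hN
  have hn' : N ^ (n + 1) = 0 := by rw [pow_succ, hn, zero_mul]
  conv_lhs => rw [IsNilpotent.exp_eq_sum hn']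
  rw [IsNilpotent.exp_eq_sum hn, map_sum, Finset.sum_range_succ', Finset.sum_mul]
  simp only [Nat.factorial_zero, pow_zero, map_smul, Derivation.map_one_eq_zero, smul_zero,
    add_zero]
  refine Finset.sum_congr rfl fun k _ => ?_
  have hk : ((k + 1).factorial : ℚ)⁻¹ * ((k + 1 : ℕ) : ℚ) = (k.factorial : ℚ)⁻¹ := by
    rw [Nat.factorial_succ]
    push_cast
    field_simp
  rw [Derivation.leibniz_pow, Nat.add_sub_cancel, ← Nat.cast_smul_eq_nsmul ℚ, smul_smul, hk,
    smul_eq_mul, smul_mul_assoc]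

theorem nilExp_eq_isNilpotent_exp {A : Type*} [CommRing A] [Algebra ℚ A] {N : A}
    (hN : IsNilpotent N) : nilExp N = IsNilpotent.exp N := by
  classical
  rw [nilExp, dif_pos hN]
  exact (IsNilpotent.exp_eq_sum (Nat.find_spec hN)).symm

/-- An additive equivalence intertwining two endomorphisms restricts to their kernels. -/
def AddEquiv.kerCongr {A B : Type*} [AddCommGroup A] [AddCommGroup B] (φ : A ≃+ B)
    (f : A →+ A) (g : B →+ B) (h : ∀ x, g (φ x) = φ (f x)) : f.ker ≃+ g.ker :=
  (φ.addSubgroupMap f.ker).trans <| AddEquiv.addSubgroupCongr <| by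
    ext y
    obtain ⟨x, rfl⟩ := φ.surjective y
    simp [AddMonoidHom.mem_ker, h]

@[simp]
theorem AddEquiv.coe_kerCongr_apply {A B : Type*} [AddCommGroup A] [AddCommGroup B] (φ : A ≃+ B)
    (f : A →+ A) (g : B →+ B) (h : ∀ x, g (φ x) = φ (f x)) (x : f.ker) :
    (φ.kerCongr f g h x : B) = φ x := rfl

theorem AddEquiv.map_kerCongr_range {A B : Type*} [AddCommGroup A] [AddCommGroup B] (φ : A ≃+ B)
    (f : A →+ A) (g : B →+ B) (h : ∀ x, g (φ x) = φ (f x)) :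
    (f.range.addSubgroupOf f.ker).map (φ.kerCongr f g h : f.ker →+ g.ker) =
      g.range.addSubgroupOf g.ker := by
  ext y
  obtain ⟨x, rfl⟩ := (φ.kerCongr f g h).surjective y
  simp only [AddSubgroup.mem_map, AddMonoidHom.coe_coe, EmbeddingLike.apply_eq_iff_eq,
    exists_eq_right, AddSubgroup.mem_addSubgroupOf, AddMonoidHom.mem_range,
    AddEquiv.coe_kerCongr_apply]
  simp [φ.surjective.exists, h]

/-- local twisted de Rham isomorphism: with `D` the additive map
`d` and `DB` the twisted differential `x ↦ d x + d B · x` (both of which square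
to zero, so their kernels contain their images), multiplication by `exp(−B)`
induces an isomorphism of additive groups
`ker(d)/im(d) ≅ ker(d_{dB})/im(d_{dB})`. -/
theorem stmt4 {A : Type*} [CommRing A] [Algebra ℚ A] (d : A → A)
    (hadd : ∀ x y : A, d (x + y) = d x + d y)
    (hleib : ∀ x y : A, d (x * y) = d x * y + x * d y)
    (hdd : ∀ x : A, d (d x) = 0)
    (B : A) (hB : IsNilpotent B)
    (D : A →+ A) (hD : ∀ x : A, D x = d x)
    (DB : A →+ A) (hDB : ∀ x : A, DB x = d x + d B * x) :
    ∃ e : (D.ker ⧸ (D.range.addSubgroupOf D.ker)) ≃+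
          (DB.ker ⧸ (DB.range.addSubgroupOf DB.ker)),
      ∀ (x : D.ker) (y : DB.ker), (y : A) = nilExp (-B) * (x : A) →
        e (QuotientAddGroup.mk x) = QuotientAddGroup.mk y := by
  let δ : Derivation ℚ A A := Derivation.mk' D.toRatLinearMap fun x y => by
    simp only [AddMonoidHom.coe_toRatLinearMap, hD, hleib, smul_eq_mul]
    ring
  have hδ (x : A) : δ x = d x := hD x
  obtain ⟨u, hu⟩ := IsNilpotent.isUnit_exp hB.neg
  have hdu : d u = -(u * d B) := by
    rw [hu, ← hδ, δ.map_isNilpotent_exp hB.neg, map_neg, hδ, mul_neg]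
  let φ : A ≃+ A := DistribMulAction.toAddEquiv A u
  have hφ (x : A) : φ x = u * x := rfl
  have hcomm (x : A) : DB (φ x) = φ (D x) := by
    simp only [hφ, hDB, hD, hleib, hdu]
    ring
  refine ⟨QuotientAddGroup.congr _ _ (φ.kerCongr D DB hcomm)
    (φ.map_kerCongr_range _ _ hcomm), fun x y hxy => ?_⟩
  have hy : φ.kerCongr D DB hcomm x = y := by
    ext
    rw [AddEquiv.coe_kerCongr_apply, hφ, hxy, nilExp_eq_isNilpotent_exp hB.neg, hu]
  rw [← hy]
  rfl
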